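/- In the rational function field K(μ₁,…,μ_{n+1},X₁,…,Xₙ), let Q_μ := −d(μ₁X₁^d + ⋯ + μₙXₙ^d) − dμ_{n+1}X₁^{w₁}⋯Xₙ^{wₙ}, and for nonnegative integers a₁,…,aₙ and a positive integer p let f := X₁^{a₁}⋯Xₙ^{aₙ}/Q_μ^p. Then the d-fold partial derivative (∂/∂μ_{n+1})^d f, and the iterated mixed partial derivative ∏ᵢ₌₁ⁿ (∂/∂μᵢ)^{wᵢ} f, are both equal to d^d · p(p+1)⋯(p+d−1) · X₁^{a₁+dw₁}⋯Xₙ^{aₙ+dwₙ}/Q_μ^{p+d}. In particular (∂/∂μ_{n+1})^d f = ∏ᵢ₌₁ⁿ (∂/∂μᵢ)^{wᵢ} f. -/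

import Mathlib

open MvPolynomial

/-- The polynomial `Q_μ = -d(μ₁X₁^d + ⋯ + μₙXₙ^d) - dμ_{n+1}X₁^{w₁}⋯Xₙ^{wₙ}`
in the variables `μ₁, …, μ_{n+1}` (indexed by `Sum.inl`) and `X₁, …, Xₙ`
(indexed by `Sum.inr`). -/
noncomputable def Qmu (K : Type*) [Field K] (n d : ℕ) (w : Fin n → ℕ) :
    MvPolynomial (Fin (n + 1) ⊕ Fin n) K :=
  - C (d : K) * (∑ i : Fin n, X (Sum.inl i.castSucc) * X (Sum.inr i) ^ d)
    - C (d : K) * X (Sum.inl (Fin.last n)) * ∏ i : Fin n, X (Sum.inr i) ^ w i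

section GKZHelpers

variable {F : Type*} [Field F]

theorem gkzAux_one (D : F →+ F) (hL : ∀ x y : F, D (x * y) = x * D y + y * D x) : D 1 = 0 := by
  have := hL 1 1
  simpa using this

theorem gkzAux_nat (D : F →+ F) (hL : ∀ x y : F, D (x * y) = x * D y + y * D x) (k : ℕ) :
    D (k : F) = 0 := by
  induction k with
  | zero => simp
  | succ k ih => simp [ih, gkzAux_one D hL]

theorem gkzAux_mul (D : F →+ F) (hL : ∀ x y : F, D (x * y) = x * D y + y * D x) {x y : F}
    (hx : D x = 0) (hy : D y = 0) : D (x * y) = 0 := by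
  simp [hL, hx, hy]

theorem gkzAux_pow (D : F →+ F) (hL : ∀ x y : F, D (x * y) = x * D y + y * D x) {x : F}
    (hx : D x = 0) (k : ℕ) : D (x ^ k) = 0 := by
  induction k with
  | zero => simp [gkzAux_one D hL]
  | succ k ih => rw [pow_succ]; exact gkzAux_mul D hL ih hx

theorem gkzAux_Qpow (D : F →+ F) (hL : ∀ x y : F, D (x * y) = x * D y + y * D x) (Q : F) (k : ℕ) :
    Q * D (Q ^ k) = k * Q ^ k * D Q := by
  induction k with
  | zero => simp [gkzAux_one D hL]
  | succ k ih =>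
    rw [pow_succ, hL]
    push_cast
    linear_combination Q * ih

theorem gkzAux_step (D : F →+ F) (hL : ∀ x y : F, D (x * y) = x * D y + y * D x)
    {Q m c : F} (hQ : Q ≠ 0) (hDQ : D Q = -c * m) {g : F} (hg : D g = 0) (p : ℕ) :
    D (g / Q ^ p) = (p : F) * (c * m * g) / Q ^ (p + 1) := by
  have h1 : D (Q ^ p * (g / Q ^ p)) = 0 := by
    rw [mul_div_cancel₀ _ (pow_ne_zero _ hQ)]; exact hg
  rw [hL] at h1
  have h2 := gkzAux_Qpow D hL Q p
  rw [hDQ] at h2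
  rw [eq_div_iff (pow_ne_zero _ hQ)]
  have h3 : g / Q ^ p * Q ^ p = g := div_mul_cancel₀ _ (pow_ne_zero _ hQ)
  rw [pow_succ]
  linear_combination Q * h1 - g / Q ^ p * h2 + (p : F) * c * m * h3

theorem gkzAux_iter (D : F →+ F) (hL : ∀ x y : F, D (x * y) = x * D y + y * D x)
    {Q m : F} {d : ℕ} (hQ : Q ≠ 0) (hDQ : D Q = -(d : F) * m) (hm : D m = 0) {g : F}
    (hg : D g = 0) (p k : ℕ) :
    (⇑D)^[k] (g / Q ^ p)
      = ((d ^ k * ∏ j ∈ Finset.range k, (p + j) : ℕ) : F) * (g * m ^ k) / Q ^ (p + k) := by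
  induction k with
  | zero => simp
  | succ k ih =>
    rw [Function.iterate_succ_apply', ih, gkzAux_step D hL hQ hDQ
      (gkzAux_mul D hL (gkzAux_nat D hL _) (gkzAux_mul D hL hg (gkzAux_pow D hL hm k)))]
    rw [Finset.prod_range_succ, ← add_assoc]
    congr 1
    push_cast
    ring

theorem gkzAux_list {ι : Type*} (D : ι → (F →+ F))
    (hL : ∀ i (x y : F), D i (x * y) = x * D i y + y * D i x)
    {Q : F} {m : ι → F} {d : ℕ} (hQ : Q ≠ 0) (hDQ : ∀ i, D i Q = -(d : F) * m i)
    (hm : ∀ i j, D i (m j) = 0) {g : F}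
    (hg : ∀ i, D i g = 0) (p : ℕ) (w : ι → ℕ) (L : List ι) :
    ((L.map fun i => (⇑(D i))^[w i]).foldr (· ∘ ·) id) (g / Q ^ p)
      = ((d ^ (L.map w).sum * ∏ j ∈ Finset.range (L.map w).sum, (p + j) : ℕ) : F)
        * (g * (L.map fun i => m i ^ w i).prod) / Q ^ (p + (L.map w).sum) := by
  induction L with
  | nil => simp
  | cons i L ih =>
    simp only [List.map_cons, List.foldr_cons, Function.comp_apply, List.sum_cons, List.prod_cons]
    rw [ih]
    have hP : D i (L.map fun i => m i ^ w i).prod = 0 := by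
      clear ih
      induction L with
      | nil => simp [gkzAux_one (D i) (hL i)]
      | cons j L ih =>
        simp only [List.map_cons, List.prod_cons]
        exact gkzAux_mul _ (hL i) (gkzAux_pow _ (hL i) (hm i j) _) ih
    rw [gkzAux_iter (D i) (hL i) hQ (hDQ i) (hm i i)
      (gkzAux_mul _ (hL i) (gkzAux_nat _ (hL i) _) (gkzAux_mul _ (hL i) (hg i) hP))]
    rw [add_comm (w i), Finset.prod_range_add, ← add_assoc]
    congr 1
    simp only [← add_assoc]
    push_cast
    ring

end GKZHelpers

theorem gkzAux_pderiv_X {K : Type*} [Field K] {n : ℕ} (v : Fin (n + 1)) (e : Fin n → ℕ)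
    (s : Finset (Fin n)) :
    pderiv (Sum.inl v) (∏ i ∈ s, X (Sum.inr i) ^ e i :
      MvPolynomial (Fin (n + 1) ⊕ Fin n) K) = 0 := by
  classical
  induction s using Finset.induction_on with
  | empty => simp
  | insert i s hi ih =>
    rw [Finset.prod_insert hi, pderiv_mul, ih, pderiv_pow, pderiv_X_of_ne (by simp)]
    simp

theorem gkzAux_Q_last {K : Type*} [Field K] (n d : ℕ) (w : Fin n → ℕ) :
    pderiv (Sum.inl (Fin.last n)) (Qmu K n d w)
      = -(d : MvPolynomial (Fin (n + 1) ⊕ Fin n) K) * ∏ i : Fin n, X (Sum.inr i) ^ w i := by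
  have h : ∀ i : Fin n, pderiv (Sum.inl (Fin.last n))
      (X (Sum.inl i.castSucc) * X (Sum.inr i) ^ d : MvPolynomial (Fin (n + 1) ⊕ Fin n) K) = 0 := by
    intro i
    rw [pderiv_mul, pderiv_pow, pderiv_X_of_ne (by simp),
      pderiv_X_of_ne (by simp)]
    simp
  rw [Qmu, ← C_neg, map_sub, pderiv_C_mul, map_sum, mul_assoc, pderiv_C_mul, pderiv_mul,
    gkzAux_pderiv_X, pderiv_X_self, Finset.sum_congr rfl (fun i _ => h i)]
  simp

theorem gkzAux_Q_cast {K : Type*} [Field K] (n d : ℕ) (w : Fin n → ℕ) (j : Fin n) :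
    pderiv (Sum.inl j.castSucc) (Qmu K n d w)
      = -(d : MvPolynomial (Fin (n + 1) ⊕ Fin n) K) * X (Sum.inr j) ^ d := by
  have h : ∀ i : Fin n, pderiv (Sum.inl j.castSucc)
      (X (Sum.inl i.castSucc) * X (Sum.inr i) ^ d : MvPolynomial (Fin (n + 1) ⊕ Fin n) K)
        = if i = j then X (Sum.inr j) ^ d else 0 := by
    intro i
    rw [pderiv_mul, pderiv_pow, pderiv_X_of_ne (i := Sum.inl j.castSucc) (j := Sum.inr i) (by simp)]
    split_ifs with hij
    · subst hij; simp
    · rw [pderiv_X_of_ne (by simpa using hij)]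
      simp
  rw [Qmu, ← C_neg, map_sub, pderiv_C_mul, map_sum, mul_assoc, pderiv_C_mul, pderiv_mul,
    gkzAux_pderiv_X, pderiv_X_of_ne (by simp [(Fin.castSucc_lt_last j).ne']),
    Finset.sum_congr rfl (fun i _ => h i)]
  simp

/-- Equation (3.4) (`eq:1st`) of the GKZ system:  in the rational function
field `F = K(μ₁,…,μ_{n+1},X₁,…,Xₙ)`, for `f = X₁^{a₁}⋯Xₙ^{aₙ}/Q_μ^p`, both
`(∂/∂μ_{n+1})^d f` and `∏ᵢ (∂/∂μᵢ)^{wᵢ} f` equal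
`d^d·p(p+1)⋯(p+d-1)·X₁^{a₁+dw₁}⋯Xₙ^{aₙ+dwₙ}/Q_μ^{p+d}`; in particular they
agree.  The partial derivatives are given as additive maps `D v` on `F`
satisfying the Leibniz rule and extending the formal partial derivatives
`pderiv v` of the polynomial ring (such extensions are unique). -/
theorem gkz_first_equation {K : Type*} [Field K] [CharZero K]
    (n d : ℕ) (hn : 1 ≤ n) (hd : 1 ≤ d)
    (w : Fin n → ℕ) (hw : ∀ i, 0 < w i) (hsum : ∑ i, w i = d)
    {F : Type*} [Field F]
    [Algebra (MvPolynomial (Fin (n + 1) ⊕ Fin n) K) F]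
    [IsFractionRing (MvPolynomial (Fin (n + 1) ⊕ Fin n) K) F]
    (D : (Fin (n + 1) ⊕ Fin n) → (F →+ F))
    (hLeib : ∀ v (x y : F), D v (x * y) = x * D v y + y * D v x)
    (hExt : ∀ v q, D v (algebraMap (MvPolynomial (Fin (n + 1) ⊕ Fin n) K) F q)
      = algebraMap (MvPolynomial (Fin (n + 1) ⊕ Fin n) K) F (pderiv v q))
    (a : Fin n → ℕ) (p : ℕ) (hp : 0 < p) :
    (⇑(D (Sum.inl (Fin.last n))))^[d]
        (algebraMap (MvPolynomial (Fin (n + 1) ⊕ Fin n) K) F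
            (∏ i : Fin n, X (Sum.inr i) ^ a i)
          / (algebraMap (MvPolynomial (Fin (n + 1) ⊕ Fin n) K) F (Qmu K n d w)) ^ p)
      = ((d ^ d * ∏ k ∈ Finset.range d, (p + k) : ℕ) : F)
          * algebraMap (MvPolynomial (Fin (n + 1) ⊕ Fin n) K) F
              (∏ i : Fin n, X (Sum.inr i) ^ (a i + d * w i))
          / (algebraMap (MvPolynomial (Fin (n + 1) ⊕ Fin n) K) F (Qmu K n d w)) ^ (p + d)
    ∧
    ((List.ofFn fun i : Fin n => (⇑(D (Sum.inl i.castSucc)))^[w i]).foldr (· ∘ ·) id)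
        (algebraMap (MvPolynomial (Fin (n + 1) ⊕ Fin n) K) F
            (∏ i : Fin n, X (Sum.inr i) ^ a i)
          / (algebraMap (MvPolynomial (Fin (n + 1) ⊕ Fin n) K) F (Qmu K n d w)) ^ p)
      = ((d ^ d * ∏ k ∈ Finset.range d, (p + k) : ℕ) : F)
          * algebraMap (MvPolynomial (Fin (n + 1) ⊕ Fin n) K) F
              (∏ i : Fin n, X (Sum.inr i) ^ (a i + d * w i))
          / (algebraMap (MvPolynomial (Fin (n + 1) ⊕ Fin n) K) F (Qmu K n d w)) ^ (p + d) := by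
  have hX : ∀ (e : Fin n → ℕ) (v : Fin (n + 1)), D (Sum.inl v)
      (algebraMap (MvPolynomial (Fin (n + 1) ⊕ Fin n) K) F
        (∏ i : Fin n, X (Sum.inr i) ^ e i)) = 0 := by
    intro e v
    rw [hExt, gkzAux_pderiv_X, map_zero]
  have hQ0 : Qmu K n d w ≠ 0 := by
    intro h
    have h1 := gkzAux_Q_last (K := K) n d w
    rw [h, map_zero, eq_comm, mul_eq_zero, neg_eq_zero, Nat.cast_eq_zero,
      Finset.prod_eq_zero_iff] at h1
    rcases h1 with h1 | ⟨i, -, h1⟩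
    · omega
    · exact pow_ne_zero _ (X_ne_zero _) h1
  have hQ : algebraMap (MvPolynomial (Fin (n + 1) ⊕ Fin n) K) F (Qmu K n d w) ≠ 0 := by
    intro h
    exact hQ0 ((IsFractionRing.injective (MvPolynomial (Fin (n + 1) ⊕ Fin n) K) F)
      (h.trans (map_zero _).symm))
  constructor
  · rw [gkzAux_iter (D (Sum.inl (Fin.last n))) (hLeib _) hQ (d := d)
      (m := algebraMap (MvPolynomial (Fin (n + 1) ⊕ Fin n) K) F (∏ i : Fin n, X (Sum.inr i) ^ w i))
      (by rw [hExt, gkzAux_Q_last]; simp) (hX _ _) (hX _ _), ← map_pow, ← map_mul,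
      ← Finset.prod_pow, ← Finset.prod_mul_distrib]
    congr 4
    funext i
    rw [pow_add, mul_comm d, pow_mul]
  · rw [List.ofFn_eq_map, gkzAux_list (fun i : Fin n => D (Sum.inl i.castSucc))
      (fun i => hLeib _) hQ (d := d)
      (m := fun i => algebraMap (MvPolynomial (Fin (n + 1) ⊕ Fin n) K) F (X (Sum.inr i) ^ d))
      (fun i => by rw [hExt, gkzAux_Q_cast]; simp)
      (fun i j => by
        rw [hExt, pderiv_pow, pderiv_X_of_ne (by simp)]
        simp) (fun i => hX _ _)]
    rw [← List.ofFn_eq_map, ← List.ofFn_eq_map, List.sum_ofFn, List.prod_ofFn, hsum]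
    simp only [← map_pow]
    rw [← map_prod, ← map_mul, ← Finset.prod_mul_distrib]
    congr 4
    funext i
    rw [pow_add, pow_mul]
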